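/- Let S = R ∪ B be a bicolored point set in convex position with |R| = |B| + 1 = n + 1 ≥ 2, and let r, r' ∈ R be consecutive points in the circular order of S. Then every optimum Hamiltonian alternating path on S with endpoints r and r' has exactly n − b(S) crossings, is 1-plane, and contains every bridge of S as an edge. -/

import Mathlib

open scoped Classical

noncomputable section

/-- Points of the plane. -/
abbrev Pt := ℝ × ℝ

/-- Orientation determinant of the ordered triple `(a, b, c)`. -/
def det2 (a b c : Pt) : ℝ :=
  (b.1 - a.1) * (c.2 - a.2) - (b.2 - a.2) * (c.1 - a.1)

/-- Two closed segments cross: some point lies in the relative interior of both. -/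
def SegCross (e f : Pt × Pt) : Prop :=
  ∃ x : Pt, x ∈ openSegment ℝ e.1 e.2 ∧ x ∈ openSegment ℝ f.1 f.2

/-- Number of crossings (unordered pairs of crossing edges) among a list of edges. -/
def crossNum (es : List (Pt × Pt)) : ℕ :=
  ((Finset.range es.length ×ˢ Finset.range es.length).filter
    (fun ij => ij.1 < ij.2 ∧
      SegCross (es.getD ij.1 ((0, 0), (0, 0))) (es.getD ij.2 ((0, 0), (0, 0))))).card

/-- Number of other edges crossing the `i`-th edge of the list. -/
def edgeCrossCount (es : List (Pt × Pt)) (i : ℕ) : ℕ :=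
  ((Finset.range es.length).filter (fun j => j ≠ i ∧
      SegCross (es.getD i ((0, 0), (0, 0))) (es.getD j ((0, 0), (0, 0))))).card

/-- Every edge is crossed by at most one other edge. -/
def OnePlane (es : List (Pt × Pt)) : Prop :=
  ∀ i ∈ Finset.range es.length, edgeCrossCount es i ≤ 1

/-- The edges of a path given by its list of vertices. -/
def pathEdges (l : List Pt) : List (Pt × Pt) := l.zip l.tail

/-- The edges of a cycle given by its list of vertices (including the wrap-around edge). -/
def cycleEdges (l : List Pt) : List (Pt × Pt) := l.zip (l.rotate 1)

/-- An edge joining a point of `R` to a point of `B`. -/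
def Bichromatic (R B : Finset Pt) (e : Pt × Pt) : Prop :=
  (e.1 ∈ R ∧ e.2 ∈ B) ∨ (e.1 ∈ B ∧ e.2 ∈ R)

/-- A Hamiltonian alternating path on the bicolored point set `R ∪ B`
with endpoints `p` and `q`. -/
structure HamAltPath (R B : Finset Pt) (p q : Pt) where
  verts : List Pt
  nodup : verts.Nodup
  cover : verts.toFinset = R ∪ B
  head_eq : verts.head? = some p
  last_eq : verts.getLast? = some q
  alt : ∀ e ∈ pathEdges verts, Bichromatic R B e

/-- A Hamiltonian alternating cycle on the bicolored point set `R ∪ B`. -/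
structure HamAltCycle (R B : Finset Pt) where
  verts : List Pt
  nodup : verts.Nodup
  cover : verts.toFinset = R ∪ B
  alt : ∀ e ∈ cycleEdges verts, Bichromatic R B e

/-- A Hamiltonian alternating path with prescribed endpoints is optimum if it has the
minimum number of crossings among all such paths. -/
def OptimumPath (R B : Finset Pt) (p q : Pt) (P : HamAltPath R B p q) : Prop :=
  ∀ Q : HamAltPath R B p q, crossNum (pathEdges P.verts) ≤ crossNum (pathEdges Q.verts)

/-- No three points of `S` are collinear. -/
def GeneralPosition (S : Finset Pt) : Prop :=
  ∀ p ∈ S, ∀ q ∈ S, ∀ r ∈ S, p ≠ q → p ≠ r → q ≠ r → ¬ Collinear ℝ ({p, q, r} : Set Pt)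

/-- Every point of `S` is a vertex (extreme point) of its convex hull. -/
def ConvexPosition (S : Finset Pt) : Prop :=
  ∀ p ∈ S, p ∉ convexHull ℝ ((S.erase p : Finset Pt) : Set Pt)

/-- The points of `S` lying on the boundary of the convex hull of `S`
(i.e. the extreme points of `S`). -/
def hullPts (S : Finset Pt) : Finset Pt :=
  S.filter fun p => p ∉ convexHull ℝ ((S.erase p : Finset Pt) : Set Pt)

/-- Cyclic successor on `Fin m`. -/
def cycSucc {m : ℕ} (hm : 0 < m) (i : Fin m) : Fin m :=
  ⟨(i.val + 1) % m, Nat.mod_lt _ hm⟩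

/-- Cyclic predecessor on `Fin m`. -/
def cycPred {m : ℕ} (hm : 0 < m) (i : Fin m) : Fin m :=
  ⟨(i.val + (m - 1)) % m, Nat.mod_lt _ hm⟩

/-- `pt` lists points in convex position, in clockwise circular order:
every index-increasing triple is clockwise oriented. -/
def CWList {m : ℕ} (pt : Fin m → Pt) : Prop :=
  Function.Injective pt ∧
    ∀ i j k : Fin m, i < j → j < k → det2 (pt i) (pt j) (pt k) < 0

/-- `pt` is a clockwise listing of the points of `S` on the boundary of `CH(S)`. -/
def IsHullList (S : Finset Pt) {m : ℕ} (pt : Fin m → Pt) : Prop :=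
  CWList pt ∧ Finset.univ.image pt = hullPts S

/-- The number of runs of color `A` (with other color `C`) in the cyclic sequence `pt`:
a run starts at an `A`-point whose cyclic predecessor is a `C`-point; a completely
`A`-colored cycle forms a single run. -/
def runCount {m : ℕ} (hm : 0 < m) (A C : Finset Pt) (pt : Fin m → Pt) : ℕ :=
  if ∀ i : Fin m, pt i ∈ A then 1
  else (Finset.univ.filter fun i : Fin m => pt i ∈ A ∧ pt (cycPred hm i) ∈ C).card

/-- `q` is the counterclockwise radial order of the points of `T` around `r`. -/
def CCWOrder (r : Pt) {k : ℕ} (q : Fin k → Pt) (T : Finset Pt) : Prop :=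
  Function.Injective q ∧ Finset.univ.image q = T ∧
    ∀ i j : Fin k, i < j → 0 < det2 r (q i) (q j)

/-- `q` is the clockwise radial order of the points of `T` around `r`. -/
def CWOrder (r : Pt) {k : ℕ} (q : Fin k → Pt) (T : Finset Pt) : Prop :=
  Function.Injective q ∧ Finset.univ.image q = T ∧
    ∀ i j : Fin k, i < j → det2 r (q i) (q j) < 0

/-- Counting one extra point of color `A` (the center), the initial segment
`q 0, …, q j` contains equally many points of color `A` and of color `C`. -/
def BalancedAt (A C : Finset Pt) {k : ℕ} (q : Fin k → Pt) (j : Fin k) : Prop :=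
  1 + (Finset.univ.filter fun i : Fin k => i ≤ j ∧ q i ∈ A).card
    = (Finset.univ.filter fun i : Fin k => i ≤ j ∧ q i ∈ C).card

/-- `j` is the first balanced index of the sequence `q`. -/
def FirstBalanced (A C : Finset Pt) {k : ℕ} (q : Fin k → Pt) (j : Fin k) : Prop :=
  BalancedAt A C q j ∧ ∀ j' : Fin k, j' < j → ¬ BalancedAt A C q j'

/-- The triple `(R ∪ B, r, b)` is a special configuration (Definition 2.2):
(i) both neighbors of `r` on the hull boundary are red and both neighbors of `b` are
blue; (ii) in the counterclockwise and clockwise radial orders around `r`, the first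
balanced point is `b`; (iii) symmetrically around `b`, the first balanced point is `r`. -/
def SpecialConfig (R B : Finset Pt) (r b : Pt) : Prop :=
  r ∈ hullPts (R ∪ B) ∧ b ∈ hullPts (R ∪ B) ∧
  (∀ (m : ℕ) (hm : 0 < m) (pt : Fin m → Pt), IsHullList (R ∪ B) pt →
    ∀ i : Fin m,
      (pt i = r → pt (cycPred hm i) ∈ R ∧ pt (cycSucc hm i) ∈ R) ∧
      (pt i = b → pt (cycPred hm i) ∈ B ∧ pt (cycSucc hm i) ∈ B)) ∧
  (∀ (k : ℕ) (q : Fin k → Pt),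
      (CCWOrder r q ((R ∪ B).erase r) ∨ CWOrder r q ((R ∪ B).erase r)) →
      ∀ j : Fin k, FirstBalanced R B q j → q j = b) ∧
  (∀ (k : ℕ) (q : Fin k → Pt),
      (CCWOrder b q ((R ∪ B).erase b) ∨ CWOrder b q ((R ∪ B).erase b)) →
      ∀ j : Fin k, FirstBalanced B R q j → q j = r)

/-- The unordered pair `{a, b}` occurs as an edge of the list `es`. -/
def IsEdgeOf (es : List (Pt × Pt)) (a b : Pt) : Prop := (a, b) ∈ es ∨ (b, a) ∈ es

/-- The clockwise cyclic interval of indices from `a` to `b`, inclusive. -/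
def cycIdx {m : ℕ} (hm : 0 < m) (a b : Fin m) : Finset (Fin m) :=
  (Finset.range ((b.val + m - a.val) % m + 1)).image
    fun t => (⟨(a.val + t) % m, Nat.mod_lt _ hm⟩ : Fin m)

/-- The unordered edges of the path visiting the list `l`. -/
def symEdges (l : List ℕ) : List (Sym2 ℕ) := (l.zip l.tail).map fun p => s(p.1, p.2)

/-- Two chords of a convex polygon with vertices labelled by `ℕ` interleave. -/
def Interleave (e f : Sym2 ℕ) : Prop :=
  (e.inf < f.inf ∧ f.inf < e.sup ∧ e.sup < f.sup) ∨
    (f.inf < e.inf ∧ e.inf < f.sup ∧ f.sup < e.sup)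

/-- The number of chords of `L` interleaving with `e`. -/
def crossDeg (L : List (Sym2 ℕ)) (e : Sym2 ℕ) : ℕ :=
  (L.map fun f => if Interleave e f then 1 else 0).sum

/-- The number of ordered pairs of interleaving chords in `L`. -/
def crossSum (L : List (Sym2 ℕ)) : ℕ := (L.map (crossDeg L)).sum

/-- The number of chords of `L` that do not join consecutive labels. -/
def farCount (L : List (Sym2 ℕ)) : ℕ :=
  (L.map fun e => if e.inf + 1 = e.sup then 0 else 1).sum

lemma interleave_comm {e f : Sym2 ℕ} : Interleave e f ↔ Interleave f e := by
  unfold Interleave; tauto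

lemma not_interleave_self (e : Sym2 ℕ) : ¬ Interleave e e := by
  unfold Interleave; omega

lemma interleave_mk {a b c d : ℕ} : Interleave s(a, b) s(c, d) ↔
    (min a b < min c d ∧ min c d < max a b ∧ max a b < max c d) ∨
    (min c d < min a b ∧ min a b < max c d ∧ max c d < max a b) := by
  simp [Interleave]

lemma not_interleave_of_adjacent {e f : Sym2 ℕ} (he : e.inf + 1 = e.sup) :
    ¬ Interleave e f := by
  unfold Interleave; omega

lemma interleave_mk_iff {a b c d : ℕ} : Interleave s(a, b) s(c, d) ↔
    (a < c ∧ c < b ∧ b < d) ∨ (a < d ∧ d < b ∧ b < c) ∨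
    (b < c ∧ c < a ∧ a < d) ∨ (b < d ∧ d < a ∧ a < c) ∨
    (c < a ∧ a < d ∧ d < b) ∨ (c < b ∧ b < d ∧ d < a) ∨
    (d < a ∧ a < c ∧ c < b) ∨ (d < b ∧ b < c ∧ c < a) := by
  rw [interleave_mk]
  rcases le_total a b with h | h <;> rcases le_total c d with h' | h' <;>
    simp only [min_eq_left, max_eq_right, min_eq_right, max_eq_left, h, h'] <;>
    constructor <;> intro H <;> rcases H with H | H <;> omega

lemma interleave_mk_of_le {a b i j : ℕ} (hij : i ≤ j) : Interleave s(a, b) s(i, j) ↔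
    ((a < i ∨ j < a) ∧ i < b ∧ b < j) ∨ ((b < i ∨ j < b) ∧ i < a ∧ a < j) := by
  rw [interleave_mk_iff]
  constructor <;> intro H <;> rcases H with H | H <;> omega

lemma interleave_exchange {u v w x : ℕ} (h : Interleave s(u, v) s(w, x)) (g : Sym2 ℕ) :
    (if Interleave s(u, w) g then 1 else 0) + (if Interleave s(v, x) g then 1 else 0) ≤
    (if Interleave s(u, v) g then 1 else 0) + (if Interleave s(w, x) g then 1 else 0) := by
  induction g with | _ i j =>
  wlog hij : i ≤ j generalizing i j
  · rw [Sym2.eq_swap (a := i)]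
    exact this j i (by omega)
  rw [interleave_mk_iff] at h
  simp only [interleave_mk_of_le hij]
  rcases h with h | h | h | h | h | h | h | h <;> obtain ⟨h1, h2, h3⟩ := h <;>
    split_ifs <;> first | (simp; done) | omega

lemma not_interleave_exchange {u v w x : ℕ} (h : Interleave s(u, v) s(w, x)) :
    ¬ Interleave s(u, w) s(v, x) := by
  rw [interleave_mk_iff] at *
  rcases h with h | h | h | h | h | h | h | h <;> omega

@[simp] lemma symEdges_nil : symEdges [] = [] := rfl
@[simp] lemma symEdges_singleton (a : ℕ) : symEdges [a] = [] := rfl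
@[simp] lemma symEdges_cons_cons (a b : ℕ) (l : List ℕ) :
    symEdges (a :: b :: l) = s(a, b) :: symEdges (b :: l) := rfl

lemma symEdges_append {A B : List ℕ} {a b : ℕ} (hA : A.getLast? = some a)
    (hB : B.head? = some b) : symEdges (A ++ B) = symEdges A ++ s(a, b) :: symEdges B := by
  induction A with
  | nil => simp at hA
  | cons x A ih =>
    cases A with
    | nil =>
      cases B with
      | nil => simp at hB
      | cons y B => simp_all
    | cons y A => simp_all

lemma symEdges_reverse (l : List ℕ) : symEdges l.reverse = (symEdges l).reverse := by
  induction l with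
  | nil => rfl
  | cons a l ih =>
    cases l with
    | nil => rfl
    | cons b l =>
      rw [List.reverse_cons, symEdges_append (a := b) (b := a) (by simp) (by simp), ih]
      simp [Sym2.eq_swap]

lemma mem_symEdges_append_left {l : List ℕ} (l' : List ℕ) {e : Sym2 ℕ}
    (he : e ∈ symEdges l) : e ∈ symEdges (l ++ l') := by
  induction l with
  | nil => simp at he
  | cons a l ih =>
    cases l with
    | nil => simp at he
    | cons b l =>
      simp only [symEdges_cons_cons, List.mem_cons, List.cons_append] at he ih ⊢
      exact he.imp_right ih

lemma mem_symEdges_append_right (l : List ℕ) {l' : List ℕ} {e : Sym2 ℕ}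
    (he : e ∈ symEdges l') : e ∈ symEdges (l ++ l') := by
  have := mem_symEdges_append_left l.reverse (e := e) (l := l'.reverse)
    (by rwa [symEdges_reverse, List.mem_reverse])
  rwa [← List.reverse_append, symEdges_reverse, List.mem_reverse] at this

lemma mem_of_mem_symEdges {l : List ℕ} {e : Sym2 ℕ} (he : e ∈ symEdges l) :
    ∀ x ∈ e, x ∈ l := by
  induction l with
  | nil => simp at he
  | cons a l ih =>
    cases l with
    | nil => simp at he
    | cons b l =>
      rw [symEdges_cons_cons, List.mem_cons] at he
      rcases he with rfl | he
      · intro x hx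
        rw [Sym2.mem_iff] at hx
        rcases hx with rfl | rfl <;> simp
      · intro x hx
        exact List.mem_cons_of_mem _ (ih he x hx)

lemma symEdges_nodup {l : List ℕ} (hl : l.Nodup) : (symEdges l).Nodup := by
  induction l with
  | nil => simp
  | cons a l ih =>
    cases l with
    | nil => simp
    | cons b l =>
      rw [symEdges_cons_cons, List.nodup_cons]
      rw [List.nodup_cons] at hl
      exact ⟨fun h => hl.1 (mem_of_mem_symEdges h a (by simp)), ih hl.2⟩

lemma exists_split_of_mem_symEdges {l : List ℕ} {e : Sym2 ℕ} (he : e ∈ symEdges l) :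
    ∃ A u v B, l = A ++ B ∧ A.getLast? = some u ∧ B.head? = some v ∧ e = s(u, v) := by
  induction l with
  | nil => simp at he
  | cons a l ih =>
    cases l with
    | nil => simp at he
    | cons b l =>
      rw [symEdges_cons_cons, List.mem_cons] at he
      rcases he with rfl | he
      · exact ⟨[a], a, b, b :: l, by simp⟩
      · obtain ⟨A, u, v, B, h1, h2, h3, h4⟩ := ih he
        refine ⟨a :: A, u, v, B, by simp [h1], ?_, h3, h4⟩
        cases A <;> simp_all

lemma exists_mem_symEdges_of_change {l : List ℕ} (Q : ℕ → Prop) {x y : ℕ} (hx : x ∈ l)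
    (hy : y ∈ l) (hQx : Q x) (hQy : ¬ Q y) : ∃ a b, s(a, b) ∈ symEdges l ∧ Q a ∧ ¬ Q b := by
  induction l generalizing x y with
  | nil => simp at hx
  | cons c l ih =>
    cases l with
    | nil => simp_all
    | cons d l =>
      by_cases hc : Q c <;> by_cases hd : Q d
      · have : y ∈ d :: l := by
          rcases List.mem_cons.1 hy with rfl | h
          · exact absurd hc hQy
          · exact h
        obtain ⟨a, b, h, h'⟩ := ih (x := d) (by simp) this hd hQy
        exact ⟨a, b, by simp [h], h'⟩
      · exact ⟨c, d, by simp, hc, hd⟩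
      · exact ⟨d, c, by simp [Sym2.eq_swap], hd, hc⟩
      · have : x ∈ d :: l := by
          rcases List.mem_cons.1 hx with rfl | h
          · exact absurd hQx hc
          · exact h
        obtain ⟨a, b, h, h'⟩ := ih (y := d) this (by simp) hQx hd
        exact ⟨a, b, by simp [h], h'⟩

lemma crossDeg_perm {L L' : List (Sym2 ℕ)} (h : L.Perm L') (e : Sym2 ℕ) :
    crossDeg L e = crossDeg L' e := (h.map _).sum_eq

lemma crossSum_perm {L L' : List (Sym2 ℕ)} (h : L.Perm L') : crossSum L = crossSum L' := by
  have : crossDeg L = crossDeg L' := funext (crossDeg_perm h)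
  unfold crossSum
  rw [this]
  exact (h.map _).sum_eq

lemma farCount_perm {L L' : List (Sym2 ℕ)} (h : L.Perm L') : farCount L = farCount L' :=
  (h.map _).sum_eq

@[simp] lemma crossDeg_nil (e : Sym2 ℕ) : crossDeg [] e = 0 := rfl

lemma crossDeg_cons (f : Sym2 ℕ) (L : List (Sym2 ℕ)) (e : Sym2 ℕ) :
    crossDeg (f :: L) e = (if Interleave e f then 1 else 0) + crossDeg L e := by
  simp [crossDeg]

lemma crossDeg_append (L L' : List (Sym2 ℕ)) (e : Sym2 ℕ) :
    crossDeg (L ++ L') e = crossDeg L e + crossDeg L' e := by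
  simp [crossDeg]

lemma crossDeg_eq_zero {L : List (Sym2 ℕ)} {e : Sym2 ℕ} :
    crossDeg L e = 0 ↔ ∀ f ∈ L, ¬ Interleave e f := by
  induction L with
  | nil => simp
  | cons a L ih => simp [crossDeg_cons, ih]

lemma crossSum_cons (e : Sym2 ℕ) (L : List (Sym2 ℕ)) :
    crossSum (e :: L) = 2 * crossDeg L e + crossSum L := by
  have h1 : (L.map (crossDeg (e :: L))).sum =
      (L.map fun f => if Interleave f e then 1 else 0).sum + (L.map (crossDeg L)).sum := by
    rw [← List.sum_map_add]
    congr 1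
  have h2 : (L.map fun f => if Interleave f e then 1 else 0).sum = crossDeg L e := by
    unfold crossDeg
    simp only [interleave_comm (f := e)]
  unfold crossSum
  rw [List.map_cons, List.sum_cons, h1, h2, crossDeg_cons, if_neg (not_interleave_self e)]
  omega

lemma crossSum_append_of_forall {L L' : List (Sym2 ℕ)}
    (h : ∀ e ∈ L, ∀ f ∈ L', ¬ Interleave e f) :
    crossSum (L ++ L') = crossSum L + crossSum L' := by
  induction L with
  | nil => simp [crossSum]
  | cons e L ih =>
    rw [List.cons_append, crossSum_cons, crossSum_cons, crossDeg_append,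
      crossDeg_eq_zero.2 (h e (by simp)), ih fun a ha => h a (by simp [ha])]
    omega

lemma farCount_cons (e : Sym2 ℕ) (L : List (Sym2 ℕ)) :
    farCount (e :: L) = (if e.inf + 1 = e.sup then 0 else 1) + farCount L := by
  simp [farCount]

lemma crossDeg_exchange {u v w x : ℕ} (h : Interleave s(u, v) s(w, x)) (L : List (Sym2 ℕ)) :
    crossDeg L s(u, w) + crossDeg L s(v, x) ≤ crossDeg L s(u, v) + crossDeg L s(w, x) := by
  induction L with
  | nil => simp
  | cons g L ih =>
    have := interleave_exchange h g
    simp only [crossDeg_cons]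
    omega

/-- Reversing the subpath between two interleaving edges of a path replaces them by two
opposite sides of the quadrilateral they span. -/
lemma exists_uncrossed_path {l : List ℕ} {e f : Sym2 ℕ} (he : e ∈ symEdges l)
    (hf : f ∈ symEdges l) (hef : Interleave e f) :
    ∃ (l' : List ℕ) (u v w x : ℕ) (M : List (Sym2 ℕ)), l'.Perm l ∧ l'.head? = l.head? ∧
      l'.getLast? = l.getLast? ∧ Interleave s(u, v) s(w, x) ∧
      ((e = s(u, v) ∧ f = s(w, x)) ∨ (f = s(u, v) ∧ e = s(w, x))) ∧
      (symEdges l).Perm (s(u, v) :: s(w, x) :: M) ∧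
      (symEdges l').Perm (s(u, w) :: s(v, x) :: M) := by
  have main : ∀ {A C D : List ℕ} {u v w x : ℕ}, A.getLast? = some u → C.head? = some v →
      C.getLast? = some w → D.head? = some x → l = A ++ (C ++ D) →
      ∃ (l' : List ℕ) (M : List (Sym2 ℕ)), l'.Perm l ∧ l'.head? = l.head? ∧
        l'.getLast? = l.getLast? ∧ (symEdges l).Perm (s(u, v) :: s(w, x) :: M) ∧
        (symEdges l').Perm (s(u, w) :: s(v, x) :: M) := by
    intro A C D u v w x hA hC hC' hD hl
    refine ⟨A ++ (C.reverse ++ D), symEdges A ++ symEdges C ++ symEdges D, ?_, ?_, ?_, ?_, ?_⟩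
    · rw [hl]
      exact (List.Perm.append_right _ C.reverse_perm).append_left _
    · rw [hl]
      cases A <;> simp_all
    · rw [hl]
      obtain ⟨y, hy⟩ : ∃ y, D.getLast? = some y := by
        cases D with
        | nil => simp at hD
        | cons d D => exact ⟨_, List.getLast?_cons⟩
      simp [List.getLast?_append, hy]
    · rw [hl, symEdges_append hA (b := v) (by simp [hC]), symEdges_append hC' hD]
      refine List.perm_iff_count.2 fun a => ?_
      simp only [List.count_append, List.count_cons]
      omega
    · rw [symEdges_append hA (b := w) (by simp [hC']),
        symEdges_append (a := v) (by simp [hC]) hD, symEdges_reverse]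
      refine List.perm_iff_count.2 fun a => ?_
      simp only [List.count_append, List.count_cons, List.count_reverse]
      omega
  obtain ⟨A, u, v, B, hl, hA, hB, rfl⟩ := exists_split_of_mem_symEdges he
  rw [hl, symEdges_append hA hB, List.mem_append, List.mem_cons] at hf
  rcases hf with hf | rfl | hf
  · obtain ⟨A', u', v', C, rfl, hA', hC, rfl⟩ := exists_split_of_mem_symEdges hf
    have hCl : C.getLast? = some u := by
      cases C with
      | nil => simp at hC
      | cons c C => simpa [List.getLast?_append] using hA
    obtain ⟨l', M, h⟩ := main hA' hC hCl hB (by simpa using hl)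
    exact ⟨l', u', v', u, v, M, h.1, h.2.1, h.2.2.1, interleave_comm.1 hef,
      Or.inr ⟨rfl, rfl⟩, h.2.2.2⟩
  · exact absurd hef (not_interleave_self _)
  · obtain ⟨C, w, x, D, rfl, hC, hD, rfl⟩ := exists_split_of_mem_symEdges hf
    have hCh : C.head? = some v := by
      cases C with
      | nil => simp at hC
      | cons c C => simpa using hB
    obtain ⟨l', M, h⟩ := main hA hCh hC hD hl
    exact ⟨l', u, v, w, x, M, h.1, h.2.1, h.2.2.1, hef, Or.inl ⟨rfl, rfl⟩, h.2.2.2⟩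

/-- `l` is a Hamiltonian path on the labels `0, …, N` whose end vertices are `0` and `N`. -/
structure ExtremalPath (N : ℕ) (l : List ℕ) : Prop where
  nodup : l.Nodup
  mem_iff : ∀ x, x ∈ l ↔ x ≤ N
  ends : (l.head? = some 0 ∧ l.getLast? = some N) ∨ (l.head? = some N ∧ l.getLast? = some 0)

lemma ExtremalPath.exists_interleave {N : ℕ} {l : List ℕ} (h : ExtremalPath N l)
    {e : Sym2 ℕ} (he : e ∈ symEdges l) (hfar : e.inf + 1 ≠ e.sup) :
    ∃ f ∈ symEdges l, Interleave f e := by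
  obtain ⟨A, u, v, B, hl, hA, hB, rfl⟩ := exists_split_of_mem_symEdges he
  obtain ⟨K, rfl⟩ : ∃ K, A = K ++ [u] := ⟨_, (List.dropLast_append_getLast? u hA).symm⟩
  obtain ⟨K', rfl⟩ : ∃ K', B = v :: K' := ⟨_, (List.cons_head?_tail hB).symm⟩
  have hnd := h.nodup
  simp only [hl, List.nodup_append, List.nodup_cons, List.mem_append, List.not_mem_nil, or_false,
    List.mem_cons] at hnd
  simp only [Sym2.inf_mk, Sym2.sup_mk] at hfar
  have hfar' : min u v + 1 < max u v := by
    have : u ≠ v := hnd.2.2 u (Or.inr rfl) v (Or.inl rfl)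
    change min u v + 1 ≠ max u v at hfar
    omega
  have huN := (h.mem_iff u).1 (by simp [hl])
  have hvN := (h.mem_iff v).1 (by simp [hl])
  have cross : ∀ {K : List ℕ}, (∀ g ∈ symEdges K, g ∈ symEdges l) → ∀ p ∈ K, (p = 0 ∨ p = N) →
      min u v + 1 ∈ K → (∀ a ∈ K, a ≠ u ∧ a ≠ v) →
      ∃ f ∈ symEdges l, Interleave f s(u, v) := by
    intro K hK p hpK hp hzK hne
    have hpne := hne p hpK
    obtain ⟨a, b, hab, ha, hb⟩ := exists_mem_symEdges_of_change
      (fun t => min u v < t ∧ t < max u v) hzK hpK (by omega) (by omega)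
    refine ⟨_, hK _ hab, ?_⟩
    have h1 := hne a (mem_of_mem_symEdges hab a (by simp))
    have h2 := hne b (mem_of_mem_symEdges hab b (by simp))
    rw [interleave_mk]
    omega
  have hz : min u v + 1 ∈ l := (h.mem_iff _).2 (by omega)
  simp only [hl, List.mem_append, List.mem_cons, List.not_mem_nil, or_false] at hz
  rcases hz with (hz | hz) | hz | hz
  · obtain ⟨p, T, rfl⟩ := List.exists_cons_of_ne_nil (List.ne_nil_of_mem hz)
    refine cross (K := p :: T) (fun g hg => ?_) p (by simp) ?_ hz fun a ha => ?_
    · rw [hl, List.append_assoc]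
      exact mem_symEdges_append_left _ hg
    · have := h.ends
      simp only [hl, List.cons_append, List.head?_cons, Option.some.injEq] at this
      tauto
    · exact ⟨hnd.1.2.2 a ha u rfl, hnd.2.2 a (Or.inl ha) v (Or.inl rfl)⟩
  · omega
  · omega
  · obtain ⟨T, p, rfl⟩ := List.eq_nil_or_concat' K' |>.resolve_left (List.ne_nil_of_mem hz)
    refine cross (K := T ++ [p]) (fun g hg => ?_) p (by simp) ?_ hz fun a ha => ?_
    · rw [hl, List.append_cons]
      exact mem_symEdges_append_right _ hg
    · have := h.ends
      rw [hl] at this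
      simp only [← List.cons_append, ← List.append_assoc, List.getLast?_concat,
        Option.some.injEq] at this
      tauto
    · exact ⟨fun h => hnd.2.2 u (Or.inr rfl) a (Or.inr ha) h.symm,
        fun h => hnd.2.1.1 (h ▸ ha)⟩

lemma ExtremalPath.of_perm {N : ℕ} {l l' : List ℕ} (h : ExtremalPath N l) (hp : l'.Perm l)
    (hh : l'.head? = l.head?) (hl : l'.getLast? = l.getLast?) : ExtremalPath N l' :=
  ⟨hp.nodup_iff.2 h.nodup, fun x => hp.mem_iff.trans (h.mem_iff x), by rw [hh, hl]; exact h.ends⟩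

lemma not_adjacent_of_interleave {e f : Sym2 ℕ} (h : Interleave e f) : e.inf + 1 ≠ e.sup :=
  fun h' => not_interleave_of_adjacent h' h

lemma farCount_eq_zero {L : List (Sym2 ℕ)} (h : ∀ e ∈ L, e.inf + 1 = e.sup) :
    farCount L = 0 := by
  induction L with
  | nil => rfl
  | cons e L ih =>
    rw [farCount_cons, if_pos (h e (by simp)), ih fun a ha => h a (by simp [ha])]

theorem ExtremalPath.farCount_le {N : ℕ} {l : List ℕ} (h : ExtremalPath N l) :
    farCount (symEdges l) ≤ crossSum (symEdges l) := by
  induction hc : crossSum (symEdges l) using Nat.strong_induction_on generalizing l with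
  | _ c ih =>
  by_cases H : ∃ e ∈ symEdges l, e.inf + 1 ≠ e.sup
  · obtain ⟨e, he, hfar⟩ := H
    obtain ⟨f, hf, hfe⟩ := h.exists_interleave he hfar
    obtain ⟨l', u, v, w, x, M, hp, hh, hlast, hX, -, hM, hM'⟩ := exists_uncrossed_path hf he hfe
    have h' := h.of_perm hp hh hlast
    have hs := crossSum_perm hM
    have hs' := crossSum_perm hM'
    have hn := farCount_perm hM
    have hn' := farCount_perm hM'
    simp only [crossSum_cons, crossDeg_cons, farCount_cons, if_pos hX,
      if_neg (not_interleave_exchange hX), if_neg (not_adjacent_of_interleave hX),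
      if_neg (not_adjacent_of_interleave (interleave_comm.1 hX))] at hs hs' hn hn'
    have hle := crossDeg_exchange hX M
    have := ih _ (by omega) h' rfl
    omega
  · push Not at H
    rw [farCount_eq_zero H]
    omega

theorem ExtremalPath.crossDeg_eq_one {N : ℕ} {l : List ℕ} (h : ExtremalPath N l)
    (heq : farCount (symEdges l) = crossSum (symEdges l)) {e f : Sym2 ℕ} (he : e ∈ symEdges l)
    (hf : f ∈ symEdges l) (hef : Interleave e f) : crossDeg (symEdges l) e = 1 := by
  obtain ⟨l', u, v, w, x, M, hp, hh, hlast, hX, hor, hM, hM'⟩ := exists_uncrossed_path he hf hef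
  have hfar := (h.of_perm hp hh hlast).farCount_le
  have hs := crossSum_perm hM
  have hs' := crossSum_perm hM'
  have hn := farCount_perm hM
  have hn' := farCount_perm hM'
  simp only [crossSum_cons, crossDeg_cons, farCount_cons, if_pos hX,
    if_neg (not_interleave_exchange hX), if_neg (not_adjacent_of_interleave hX),
    if_neg (not_adjacent_of_interleave (interleave_comm.1 hX))] at hs hs' hn hn'
  have hle := crossDeg_exchange hX M
  have hadj : ∀ {g : Sym2 ℕ}, g.inf + 1 = g.sup → crossDeg M g = 0 := fun hg =>
    crossDeg_eq_zero.2 fun _ _ => not_interleave_of_adjacent hg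
  have h0 : crossDeg M s(u, v) = 0 ∧ crossDeg M s(w, x) = 0 := by
    by_cases h1 : (s(u, w) : Sym2 ℕ).inf + 1 = (s(u, w) : Sym2 ℕ).sup
    · by_cases h2 : (s(v, x) : Sym2 ℕ).inf + 1 = (s(v, x) : Sym2 ℕ).sup
      · have := hadj h1
        have := hadj h2
        rw [if_pos h1, if_pos h2] at hn'
        omega
      · rw [if_pos h1, if_neg h2] at hn'
        omega
    · rw [if_neg h1] at hn'
      split_ifs at hn' <;> omega
  rw [crossDeg_perm hM]
  rcases hor with ⟨rfl, rfl⟩ | ⟨rfl, rfl⟩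
  · simp [crossDeg_cons, not_interleave_self, hX, h0]
  · simp [crossDeg_cons, not_interleave_self, interleave_comm.1 hX, h0]

/-- The number of `t ∈ [i, j)` such that `t` and `t + 1` have the same color. -/
def monoCount (col : ℕ → Bool) (i j : ℕ) : ℕ :=
  ∑ t ∈ Finset.Ico i j, if col t = col (t + 1) then 1 else 0

/-- `l` is an alternating path on `i, …, j` from `i` to `j` with as few crossings as
its monochromatic consecutive pairs allow. -/
structure LadderPath (col : ℕ → Bool) (i j : ℕ) (l : List ℕ) : Prop where
  nodup : l.Nodup
  mem_iff : ∀ x, x ∈ l ↔ i ≤ x ∧ x ≤ j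
  head_eq : l.head? = some i
  last_eq : l.getLast? = some j
  alt : ∀ a b, s(a, b) ∈ symEdges l → col a ≠ col b
  cross : crossSum (symEdges l) = monoCount col i j

lemma monoCount_split (col : ℕ → Bool) {i j k : ℕ} (hij : i ≤ j) (hjk : j < k) :
    monoCount col i k =
      monoCount col i j + (if col j = col (j + 1) then 1 else 0) + monoCount col (j + 1) k := by
  unfold monoCount
  rw [← Finset.sum_Ico_consecutive _ hij hjk.le, Finset.sum_eq_sum_Ico_succ_bot hjk]
  omega

lemma LadderPath.le {col : ℕ → Bool} {i j : ℕ} {l : List ℕ} (h : LadderPath col i j l) :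
    i ≤ j := ((h.mem_iff i).1 (List.mem_of_head? h.head_eq)).2

lemma LadderPath.bounds {col : ℕ → Bool} {i j : ℕ} {l : List ℕ} (h : LadderPath col i j l)
    {e : Sym2 ℕ} (he : e ∈ symEdges l) : i ≤ e.inf ∧ e.sup ≤ j := by
  have hm := mem_of_mem_symEdges he
  induction e with | _ a b =>
  have ha := (h.mem_iff a).1 (hm a (by simp))
  have hb := (h.mem_iff b).1 (hm b (by simp))
  simp only [Sym2.inf_mk, Sym2.sup_mk]
  exact ⟨le_inf ha.1 hb.1, sup_le ha.2 hb.2⟩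

lemma not_interleave_of_sup_le_inf {e f : Sym2 ℕ} (h : e.sup ≤ f.inf) : ¬ Interleave e f := by
  unfold Interleave
  have : f.inf ≤ f.sup := Sym2.inf_le_sup f
  have : e.inf ≤ e.sup := Sym2.inf_le_sup e
  omega

lemma LadderPath.single (col : ℕ → Bool) (i : ℕ) : LadderPath col i i [i] where
  nodup := by simp
  mem_iff x := by simp; omega
  head_eq := rfl
  last_eq := rfl
  alt := by simp
  cross := by simp [monoCount, crossSum]

lemma LadderPath.join {col : ℕ → Bool} {i j k : ℕ} {l l' : List ℕ} (h : LadderPath col i j l)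
    (h' : LadderPath col (j + 1) k l') (hc : col j ≠ col (j + 1)) :
    LadderPath col i k (l ++ l') where
  nodup := by
    refine List.nodup_append.2 ⟨h.nodup, h'.nodup, fun a ha b hb => ?_⟩
    have := (h.mem_iff a).1 ha
    have := (h'.mem_iff b).1 hb
    omega
  mem_iff x := by
    have := h.le
    have := h'.le
    rw [List.mem_append, h.mem_iff, h'.mem_iff]
    omega
  head_eq := by simp [h.head_eq]
  last_eq := by simp [List.getLast?_append, h'.last_eq]
  alt a b hab := by
    rw [symEdges_append h.last_eq h'.head_eq, List.mem_append, List.mem_cons] at hab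
    rcases hab with hab | hab | hab
    · exact h.alt a b hab
    · rcases Sym2.eq_iff.1 hab with ⟨rfl, rfl⟩ | ⟨rfl, rfl⟩
      · exact hc
      · exact hc.symm
    · exact h'.alt a b hab
  cross := by
    have hadj : (s(j, j + 1) : Sym2 ℕ).inf + 1 = (s(j, j + 1) : Sym2 ℕ).sup := by simp
    rw [symEdges_append h.last_eq h'.head_eq, crossSum_append_of_forall, crossSum_cons,
      crossDeg_eq_zero.2 fun f _ => not_interleave_of_adjacent hadj, h.cross, h'.cross,
      monoCount_split col h.le h'.le, if_neg hc]
    · omega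
    · intro e he f hf
      rcases List.mem_cons.1 hf with rfl | hf
      · exact fun hX => not_interleave_of_adjacent hadj (interleave_comm.1 hX)
      · refine not_interleave_of_sup_le_inf ?_
        have := h.bounds he
        have := h'.bounds hf
        omega

lemma LadderPath.ladder {col : ℕ → Bool} {i j k t : ℕ} {A M D : List ℕ}
    (hA : LadderPath col i j A) (hM : LadderPath col (j + 1) k M)
    (hD : LadderPath col (k + 1) t D) (hj : col j = col (j + 1)) (hk : col k = col (k + 1))
    (hjk : col j ≠ col k) : LadderPath col i t (A ++ (M.reverse ++ D)) := by
  have hE : symEdges (A ++ (M.reverse ++ D)) = symEdges A ++ s(j, k) ::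
      ((symEdges M).reverse ++ s(j + 1, k + 1) :: symEdges D) := by
    rw [symEdges_append hA.last_eq (b := k) (by simp [hM.last_eq]),
      symEdges_append (a := j + 1) (by simp [hM.head_eq]) hD.head_eq, symEdges_reverse]
  have hA' := hA.le
  have hM' := hM.le
  have hD' := hD.le
  refine ⟨?_, fun x => ?_, by simp [hA.head_eq], by simp [List.getLast?_append, hD.last_eq],
    fun a b hab => ?_, ?_⟩
  · refine List.nodup_append.2 ⟨hA.nodup, List.nodup_append.2 ⟨List.nodup_reverse.2 hM.nodup,
      hD.nodup, fun a ha b hb => ?_⟩, fun a ha b hb => ?_⟩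
    · have := (hM.mem_iff a).1 (List.mem_reverse.1 ha)
      have := (hD.mem_iff b).1 hb
      omega
    · have := (hA.mem_iff a).1 ha
      rw [List.mem_append, List.mem_reverse, hM.mem_iff, hD.mem_iff] at hb
      omega
  · rw [List.mem_append, List.mem_append, List.mem_reverse, hA.mem_iff, hM.mem_iff, hD.mem_iff]
    omega
  · rw [hE] at hab
    simp only [List.mem_append, List.mem_cons, List.mem_reverse] at hab
    have hjk' : col (j + 1) ≠ col (k + 1) := hj ▸ hk ▸ hjk
    rcases hab with hab | hab | hab | hab | hab
    · exact hA.alt a b hab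
    · rcases Sym2.eq_iff.1 hab with ⟨rfl, rfl⟩ | ⟨rfl, rfl⟩
      · exact hjk
      · exact hjk.symm
    · exact hM.alt a b hab
    · rcases Sym2.eq_iff.1 hab with ⟨rfl, rfl⟩ | ⟨rfl, rfl⟩
      · exact hjk'
      · exact hjk'.symm
    · exact hD.alt a b hab
  · have hp : (symEdges (A ++ (M.reverse ++ D))).Perm (s(j, k) :: s(j + 1, k + 1) ::
        (symEdges A ++ (symEdges M ++ symEdges D))) := by
      rw [hE]
      refine List.perm_iff_count.2 fun a => ?_
      simp only [List.count_append, List.count_cons, List.count_reverse]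
      omega
    have hkM : j + 1 ≠ k := by
      rintro rfl
      exact hjk hj
    have h1 : (s(j, k) : Sym2 ℕ).inf = j ∧ (s(j, k) : Sym2 ℕ).sup = k := by
      simp; omega
    have h2 : (s(j + 1, k + 1) : Sym2 ℕ).inf = j + 1 ∧
        (s(j + 1, k + 1) : Sym2 ℕ).sup = k + 1 := by
      simp; omega
    have hX : Interleave s(j, k) s(j + 1, k + 1) := by
      unfold Interleave; omega
    have hd : ∀ f ∈ symEdges A ++ (symEdges M ++ symEdges D),
        ¬ Interleave s(j, k) f ∧ ¬ Interleave s(j + 1, k + 1) f := by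
      intro f hf
      have := Sym2.inf_le_sup f
      simp only [List.mem_append] at hf
      unfold Interleave
      rcases hf with hf | hf | hf
      · have := hA.bounds hf
        omega
      · have := hM.bounds hf
        omega
      · have := hD.bounds hf
        omega
    rw [crossSum_perm hp, crossSum_cons, crossSum_cons, crossDeg_cons, if_pos hX,
      crossDeg_eq_zero.2 fun f hf => (hd f hf).1, crossDeg_eq_zero.2 fun f hf => (hd f hf).2,
      crossSum_append_of_forall, crossSum_append_of_forall, hA.cross, hM.cross, hD.cross,
      monoCount_split col hA' (k := t) (by omega), monoCount_split col hM' (k := t) (by omega),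
      if_pos hj, if_pos hk]
    · omega
    · intro e he f hf
      have := hM.bounds he
      have := hD.bounds hf
      exact not_interleave_of_sup_le_inf (by omega)
    · intro e he f hf
      have := hA.bounds he
      refine not_interleave_of_sup_le_inf ?_
      rcases List.mem_append.1 hf with hf | hf
      · have := hM.bounds hf
        omega
      · have := hD.bounds hf
        omega

/-- The labels `0, …, j` split into `s + 1` consecutive intervals carrying ladder paths, where the
two labels at each of the `s` boundaries have color `X`. -/
def LadderStack (col : ℕ → Bool) (X : Bool) : ℕ → ℕ → Prop
  | 0, j => ∃ l, LadderPath col 0 j l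
  | s + 1, j => ∃ i l, LadderStack col X s i ∧ col i = X ∧ col (i + 1) = X ∧
      LadderPath col (i + 1) j l

lemma LadderStack.succ {col : ℕ → Bool} {X : Bool} {s j : ℕ} (h : LadderStack col X s j)
    (hc : col j ≠ col (j + 1)) : LadderStack col X s (j + 1) := by
  cases s with
  | zero =>
    obtain ⟨l, hl⟩ := h
    exact ⟨_, hl.join (LadderPath.single col (j + 1)) hc⟩
  | succ s =>
    obtain ⟨i, l, h, h1, h2, hl⟩ := h
    exact ⟨i, _, h, h1, h2, hl.join (LadderPath.single col (j + 1)) hc⟩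

lemma LadderStack.pop {col : ℕ → Bool} {X : Bool} {s j : ℕ} (h : LadderStack col X (s + 1) j)
    (hc : col j = col (j + 1)) (hX : col j ≠ X) : LadderStack col X s (j + 1) := by
  obtain ⟨i, M, h, h1, h2, hM⟩ := h
  have hD := LadderPath.single col (j + 1)
  cases s with
  | zero =>
    obtain ⟨A, hA⟩ := h
    exact ⟨_, hA.ladder hM hD (h1.trans h2.symm) hc fun h => hX (h ▸ h1)⟩
  | succ s =>
    obtain ⟨i', A, h, h1', h2', hA⟩ := h
    exact ⟨i', _, h, h1', h2', hA.ladder hM hD (h1.trans h2.symm) hc fun h => hX (h ▸ h1)⟩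

lemma exists_ladderStack (col : ℕ → Bool) (h0 : col 0 = true) (j : ℕ) :
    ∃ X s, LadderStack col X s j ∧
      (∑ t ∈ Finset.range (j + 1), if col t then (1 : ℤ) else -1) =
        (if X then (s : ℤ) else -s) + if col j then 1 else 0 := by
  induction j with
  | zero => exact ⟨true, 0, ⟨_, LadderPath.single col 0⟩, by simp [h0]⟩
  | succ j ih =>
    obtain ⟨X, s, h, hex⟩ := ih
    rw [Finset.sum_range_succ, hex]
    by_cases hc : col j = col (j + 1)
    · rw [← hc]
      cases s with
      | zero =>
        refine ⟨col j, 1, ⟨j, _, ?_, rfl, hc.symm, LadderPath.single col (j + 1)⟩, ?_⟩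
        · exact h
        · cases col j <;> cases X <;> simp
      | succ s =>
        by_cases hX : col j = X
        · refine ⟨X, s + 2, ⟨j, _, h, hX, hc ▸ hX, LadderPath.single col (j + 1)⟩, ?_⟩
          rw [hX]
          cases X <;> simp <;> omega
        · refine ⟨X, s, h.pop hc hX, ?_⟩
          revert hX
          cases col j <;> cases X <;> simp
    · refine ⟨X, s, h.succ hc, ?_⟩
      revert hc
      cases col j <;> cases col (j + 1) <;> simp

theorem exists_ladderPath (col : ℕ → Bool) (h0 : col 0 = true) {N : ℕ} (hN : col N = true)
    (hsum : (∑ t ∈ Finset.range (N + 1), if col t then (1 : ℤ) else -1) = 1) :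
    ∃ l, LadderPath col 0 N l := by
  obtain ⟨X, s, h, hex⟩ := exists_ladderStack col h0 N
  rw [hsum, hN] at hex
  obtain rfl : s = 0 := by
    cases X <;> simp at hex <;> omega
  exact h

lemma monoCount_add (col : ℕ → Bool) (h0 : col 0 = true) (N : ℕ) :
    monoCount col 0 N +
      2 * ((Finset.range N).filter fun t => col t = true ∧ col (t + 1) = false).card =
      N + if col N then 0 else 1 := by
  induction N with
  | zero => simp [monoCount, h0]
  | succ N ih =>
    unfold monoCount at ih ⊢
    rw [Finset.sum_Ico_succ_top (by omega), Finset.range_add_one, Finset.filter_insert]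
    cases h1 : col N <;> cases h2 : col (N + 1) <;>
      simp [h1, h2] at ih ⊢ <;> omega

lemma segCross_symm {e f : Pt × Pt} : SegCross e f ↔ SegCross f e := by
  simp only [SegCross, and_comm]

lemma segCross_swap_left {a b : Pt} {f : Pt × Pt} : SegCross (a, b) f ↔ SegCross (b, a) f := by
  simp only [SegCross, openSegment_symm ℝ a b]

lemma not_segCross_of_det2 {p q u v : Pt} (ε : ℝ) (hu : 0 ≤ ε * det2 p q u)
    (hv : 0 ≤ ε * det2 p q v) (h : 0 < ε * det2 p q u + ε * det2 p q v) :
    ¬ SegCross (p, q) (u, v) := by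
  rintro ⟨x, ⟨a, b, ha, hb, hab, rfl⟩, ⟨c, d, hc, hd, hcd, hx⟩⟩
  have h0 : c * (ε * det2 p q u) + d * (ε * det2 p q v) = 0 := by
    have h1 := congrArg Prod.fst hx
    have h2 := congrArg Prod.snd hx
    simp only [Prod.fst_add, Prod.snd_add, Prod.smul_fst, Prod.smul_snd, smul_eq_mul] at h1 h2
    obtain rfl : a = 1 - b := by linarith
    obtain rfl : c = 1 - d := by linarith
    unfold det2
    linear_combination ε * (q.1 - p.1) * h2 - ε * (q.2 - p.2) * h1
  rcases hu.eq_or_lt with hu | hu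
  · have := mul_pos hd (show 0 < ε * det2 p q v by linarith)
    have := mul_nonneg hc.le hu.le
    linarith
  · have := mul_pos hc hu
    have := mul_nonneg hd.le hv
    linarith

lemma segCross_of_det2 {p q u v : Pt} (h1 : det2 p q u < 0) (h2 : det2 p q v < 0)
    (h3 : det2 p u v < 0) (h4 : det2 q u v < 0) : SegCross (p, u) (q, v) := by
  have hs : det2 q u v + det2 p q v = det2 p u v + det2 p q u := by unfold det2; ring
  have hne : det2 q u v + det2 p q v ≠ 0 := by linarith
  have hne' : det2 p u v + det2 p q u ≠ 0 := by linarith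
  refine ⟨(det2 q u v / (det2 q u v + det2 p q v)) • p +
    (det2 p q v / (det2 q u v + det2 p q v)) • u,
    ⟨_, _, div_pos_of_neg_of_neg h4 (by linarith), div_pos_of_neg_of_neg h2 (by linarith),
      by field_simp, rfl⟩,
    ⟨det2 p u v / (det2 p u v + det2 p q u), det2 p q u / (det2 p u v + det2 p q u),
      div_pos_of_neg_of_neg h3 (by linarith), div_pos_of_neg_of_neg h1 (by linarith),
      by field_simp, ?_⟩⟩
  rw [← hs]
  ext <;> simp only [Prod.fst_add, Prod.snd_add, Prod.smul_fst, Prod.smul_snd, smul_eq_mul] <;>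
    field_simp <;> unfold det2 <;> ring

lemma det2_rotate (a b c : Pt) : det2 b c a = det2 a b c := by unfold det2; ring

lemma det2_swap (a b c : Pt) : det2 a c b = -det2 a b c := by unfold det2; ring

lemma segCross_iff_interleave {P : ℕ → Pt} {N : ℕ}
    (hP : ∀ a b c, a < b → b < c → c ≤ N → det2 (P a) (P b) (P c) < 0) {a b c d : ℕ}
    (ha : a ≤ N) (hb : b ≤ N) (hc : c ≤ N) (hd : d ≤ N) (hab : a ≠ b) (hcd : c ≠ d)
    (hne : s(a, b) ≠ s(c, d)) :
    SegCross (P a, P b) (P c, P d) ↔ Interleave s(a, b) s(c, d) := by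
  wlog hab' : a < b generalizing a b
  · rw [segCross_swap_left, Sym2.eq_swap]
    exact this hb ha hab.symm (by rwa [Sym2.eq_swap]) (by omega)
  wlog hcd' : c < d generalizing c d
  · rw [segCross_symm, segCross_swap_left, segCross_symm, Sym2.eq_swap (a := c)]
    exact this hd hc hcd.symm (by rwa [Sym2.eq_swap (a := d)]) (by omega)
  wlog hac : a ≤ c generalizing a b c d
  · rw [segCross_symm, interleave_comm]
    exact this hc hd hcd hcd' ha hb hab hne.symm hab' (by omega)
  have hout : ∀ x, x ≤ N → b ≤ x → 0 ≤ -1 * det2 (P a) (P b) (P x) ∧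
      (b < x → 0 < -1 * det2 (P a) (P b) (P x)) := by
    intro x hx hbx
    rcases hbx.eq_or_lt with rfl | hbx
    · exact ⟨le_of_eq (by unfold det2; ring), fun h => absurd h (lt_irrefl _)⟩
    · have := hP a b x hab' hbx hx
      exact ⟨by linarith, fun _ => by linarith⟩
  have hin : ∀ x, a ≤ x → x ≤ b → 0 ≤ 1 * det2 (P a) (P b) (P x) ∧
      (a < x → x < b → 0 < 1 * det2 (P a) (P b) (P x)) := by
    intro x hax hxb
    rcases hax.eq_or_lt with rfl | hax
    · exact ⟨le_of_eq (by unfold det2; ring), fun h => absurd h (lt_irrefl _)⟩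
    rcases hxb.eq_or_lt with rfl | hxb
    · exact ⟨le_of_eq (by unfold det2; ring), fun _ h => absurd h (lt_irrefl _)⟩
    · have := hP a x b hax hxb hb
      rw [det2_swap (P a) (P x) (P b)]
      exact ⟨by linarith, fun _ _ => by linarith⟩
  rw [interleave_mk_of_le hcd'.le]
  by_cases h1 : a < c ∧ c < b ∧ b < d
  · refine iff_of_true (segCross_of_det2 ?_ ?_ ?_ ?_) (by omega) <;> apply hP <;> omega
  refine iff_of_false ?_ (by omega)
  rcases Nat.lt_or_ge c b with hcb | hcb
  · rcases Nat.lt_or_ge b d with hbd | hbd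
    · obtain rfl : a = c := by omega
      have := hout d hd hbd.le
      have h0 : det2 (P a) (P b) (P a) = 0 := by unfold det2; ring
      exact not_segCross_of_det2 (-1) (by rw [h0]; simp) this.1
        (by have := this.2 hbd; rw [h0]; linarith)
    · have h3 := hin c hac hcb.le
      have h4 := hin d (by omega) hbd
      refine not_segCross_of_det2 1 h3.1 h4.1 ?_
      rcases hac.eq_or_lt with rfl | hac
      · have : d ≠ b := fun h => hne (by rw [h])
        have := h4.2 hcd' (by omega)
        linarith [h3.1]
      · have := h3.2 hac hcb
        linarith [h4.1]
  · have h3 := hout c hc hcb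
    have h4 := hout d hd (by omega)
    have := h4.2 (by omega)
    exact not_segCross_of_det2 (-1) h3.1 h4.1 (by linarith [h3.1])

lemma sum_map_eq_sum_getD {α : Type*} (L : List α) (f : α → ℕ) (d : α) :
    (L.map f).sum = ∑ i ∈ Finset.range L.length, f (L.getD i d) := by
  induction L with
  | nil => simp
  | cons a L ih =>
    rw [List.map_cons, List.sum_cons, List.length_cons, Finset.sum_range_succ', ih, add_comm]
    simp

lemma edgeCrossCount_eq {es : List (Pt × Pt)} {L : List (Sym2 ℕ)} (hlen : es.length = L.length)
    (H : ∀ i < L.length, ∀ j < L.length, i ≠ j →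
      (SegCross (es.getD i ((0, 0), (0, 0))) (es.getD j ((0, 0), (0, 0))) ↔
        Interleave (L.getD i s(0, 0)) (L.getD j s(0, 0)))) {i : ℕ} (hi : i < L.length) :
    edgeCrossCount es i = crossDeg L (L.getD i s(0, 0)) := by
  unfold edgeCrossCount crossDeg
  rw [sum_map_eq_sum_getD _ _ s(0, 0), Finset.card_filter, hlen]
  refine Finset.sum_congr rfl fun j hj => if_congr ?_ rfl rfl
  by_cases hij : j = i
  · subst hij
    simp [not_interleave_self]
  · rw [H i hi j (Finset.mem_range.1 hj) (Ne.symm hij)]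
    exact ⟨fun h => h.2, fun h => ⟨hij, h⟩⟩

lemma two_mul_crossNum_eq {es : List (Pt × Pt)} {L : List (Sym2 ℕ)}
    (hlen : es.length = L.length)
    (H : ∀ i < L.length, ∀ j < L.length, i ≠ j →
      (SegCross (es.getD i ((0, 0), (0, 0))) (es.getD j ((0, 0), (0, 0))) ↔
        Interleave (L.getD i s(0, 0)) (L.getD j s(0, 0)))) :
    2 * crossNum es = crossSum L := by
  set g : ℕ → ℕ → ℕ := fun i j =>
    if Interleave (L.getD i s(0, 0)) (L.getD j s(0, 0)) then 1 else 0 with hg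
  have h1 : crossNum es = ∑ i ∈ Finset.range L.length, ∑ j ∈ Finset.range L.length,
      if i < j then g i j else 0 := by
    unfold crossNum
    rw [Finset.card_filter, Finset.sum_product, hlen]
    refine Finset.sum_congr rfl fun i hi => Finset.sum_congr rfl fun j hj => ?_
    by_cases hij : i < j
    · simp only [hij, true_and, if_true, hg]
      exact if_congr (H i (Finset.mem_range.1 hi) j (Finset.mem_range.1 hj) hij.ne) rfl rfl
    · simp [hij]
  have h2 : crossNum es = ∑ i ∈ Finset.range L.length, ∑ j ∈ Finset.range L.length,
      if j < i then g i j else 0 := by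
    rw [h1, Finset.sum_comm]
    refine Finset.sum_congr rfl fun i _ => Finset.sum_congr rfl fun j _ => ?_
    simp only [hg, interleave_comm]
  have h3 : crossSum L = ∑ i ∈ Finset.range L.length, ∑ j ∈ Finset.range L.length, g i j := by
    unfold crossSum
    rw [sum_map_eq_sum_getD _ _ s(0, 0)]
    refine Finset.sum_congr rfl fun i _ => ?_
    unfold crossDeg
    rw [sum_map_eq_sum_getD _ _ s(0, 0)]
  rw [two_mul, h3]
  nth_rewrite 1 [h1]
  rw [h2, ← Finset.sum_add_distrib]
  refine Finset.sum_congr rfl fun i _ => ?_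
  rw [← Finset.sum_add_distrib]
  refine Finset.sum_congr rfl fun j _ => ?_
  rcases lt_trichotomy i j with h | rfl | h
  · simp [h, h.le]
  · simp [hg, not_interleave_self]
  · simp [h, h.le]

lemma pathEdges_map (P : ℕ → Pt) (l : List ℕ) :
    pathEdges (l.map P) = (l.zip l.tail).map (Prod.map P P) := by
  rw [pathEdges, ← List.map_tail, List.zip_map]

lemma segCross_getD_iff {P : ℕ → Pt} {N : ℕ}
    (hP : ∀ a b c, a < b → b < c → c ≤ N → det2 (P a) (P b) (P c) < 0) {l : List ℕ}
    (hl : l.Nodup) (hN : ∀ x ∈ l, x ≤ N) :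
    ∀ i < (symEdges l).length, ∀ j < (symEdges l).length, i ≠ j →
      (SegCross ((pathEdges (l.map P)).getD i ((0, 0), (0, 0)))
          ((pathEdges (l.map P)).getD j ((0, 0), (0, 0))) ↔
        Interleave ((symEdges l).getD i s(0, 0)) ((symEdges l).getD j s(0, 0))) := by
  intro i hi j hj hij
  have hnd := symEdges_nodup hl
  have hmem : ∀ {a b}, s(a, b) ∈ symEdges l → a ≤ N ∧ b ≤ N ∧ a ≠ b := by
    intro a b hab
    have hm := mem_of_mem_symEdges hab
    refine ⟨hN a (hm a (by simp)), hN b (hm b (by simp)), ?_⟩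
    rintro rfl
    obtain ⟨A, u, v, B, rfl, hA, hB, he⟩ := exists_split_of_mem_symEdges hab
    have huv := (List.nodup_append.1 hl).2.2 u (List.mem_of_getLast? hA) v (List.mem_of_head? hB)
    rcases Sym2.eq_iff.1 he with ⟨rfl, rfl⟩ | ⟨rfl, rfl⟩ <;> exact huv rfl
  have hne : (symEdges l)[i] ≠ (symEdges l)[j] := fun h => hij ((hnd.getElem_inj_iff).1 h)
  have hi' := List.getElem_mem hi
  have hj' := List.getElem_mem hj
  have hi2 : i < (pathEdges (l.map P)).length := by
    simpa [pathEdges_map, symEdges] using hi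
  have hj2 : j < (pathEdges (l.map P)).length := by
    simpa [pathEdges_map, symEdges] using hj
  rw [List.getD_eq_getElem _ _ hi, List.getD_eq_getElem _ _ hj, List.getD_eq_getElem _ _ hi2,
    List.getD_eq_getElem _ _ hj2]
  simp only [pathEdges_map, List.getElem_map, symEdges, Prod.map] at hi' hj' hne ⊢
  have h1 := hmem hi'
  have h2 := hmem hj'
  exact segCross_iff_interleave hP h1.1 h1.2.1 h2.1 h2.2.1 h1.2.2 h2.2.2 hne

lemma farCount_add_length_filter (L : List (Sym2 ℕ)) :
    farCount L + (L.filter fun e => e.inf + 1 = e.sup).length = L.length := by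
  induction L with
  | nil => rfl
  | cons e L ih =>
    rw [farCount_cons, List.filter_cons]
    by_cases h : e.inf + 1 = e.sup <;> simp [h] at ih ⊢ <;> omega

lemma monoCount_add_card_bridges (col : ℕ → Bool) (N : ℕ) :
    monoCount col 0 N + ((Finset.range N).filter fun t => col t ≠ col (t + 1)).card = N := by
  have := Finset.card_filter_add_card_filter_not (s := Finset.range N)
    (fun t => col t = col (t + 1))
  rw [Finset.card_range] at this
  rw [monoCount, ← Finset.card_filter, ← Finset.range_eq_Ico]
  exact this

lemma ExtremalPath.length_symEdges {N : ℕ} {l : List ℕ} (h : ExtremalPath N l) :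
    (symEdges l).length = N := by
  have h1 : l.toFinset = Finset.range (N + 1) := by
    ext x
    simp [h.mem_iff]
  have h2 := List.toFinset_card_of_nodup h.nodup
  rw [h1, Finset.card_range] at h2
  simp [symEdges, ← h2]

/-- The adjacent pairs used by an alternating path are bridges, so the path has at least as many
far edges as there are monochromatic adjacent pairs, with equality only if it uses all bridges. -/
lemma ExtremalPath.monoCount_le {col : ℕ → Bool} {N : ℕ} {l : List ℕ} (h : ExtremalPath N l)
    (halt : ∀ a b, s(a, b) ∈ symEdges l → col a ≠ col b) :
    monoCount col 0 N ≤ farCount (symEdges l) ∧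
      (farCount (symEdges l) = monoCount col 0 N →
        ∀ t < N, col t ≠ col (t + 1) → s(t, t + 1) ∈ symEdges l) := by
  set T := (Finset.range N).filter fun t => col t ≠ col (t + 1) with hT
  set F := (symEdges l).filter fun e => e.inf + 1 = e.sup with hF
  have hsub : F.toFinset ⊆ T.image fun t => s(t, t + 1) := by
    intro e he
    simp only [hF, List.mem_toFinset, List.mem_filter, decide_eq_true_eq] at he
    obtain ⟨he, hadj⟩ := he
    have hmem := mem_of_mem_symEdges he
    have hs : s(e.inf, e.sup) = e := by
      induction e with | _ a b =>
      rcases le_total a b with h | h <;> simp [h, Sym2.eq_swap]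
    rw [← hadj] at hs
    have hsup : e.inf + 1 ∈ s(e.inf, e.inf + 1) := by simp
    rw [hs] at hsup
    have := (h.mem_iff _).1 (hmem _ hsup)
    refine Finset.mem_image.2 ⟨e.inf, ?_, hs⟩
    rw [hT, Finset.mem_filter, Finset.mem_range]
    exact ⟨by omega, halt _ _ (by rwa [hs])⟩
  have hcard : F.toFinset.card = F.length :=
    List.toFinset_card_of_nodup ((symEdges_nodup h.nodup).filter _)
  have h1 := farCount_add_length_filter (symEdges l)
  rw [h.length_symEdges, ← hF] at h1
  have h2 := monoCount_add_card_bridges col N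
  rw [← hT] at h2
  have h3 := Finset.card_le_card hsub
  have h4 : (T.image fun t => (s(t, t + 1) : Sym2 ℕ)).card ≤ T.card := Finset.card_image_le
  refine ⟨by omega, fun heq t ht hc => ?_⟩
  have hset := Finset.eq_of_subset_of_card_le hsub (by omega)
  have : s(t, t + 1) ∈ F.toFinset := by
    rw [hset]
    exact Finset.mem_image.2 ⟨t, by simp [hT, ht, hc], rfl⟩
  exact (List.mem_filter.1 (List.mem_toFinset.1 this)).1

lemma LadderPath.extremalPath {col : ℕ → Bool} {N : ℕ} {l : List ℕ} (h : LadderPath col 0 N l) :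
    ExtremalPath N l :=
  ⟨h.nodup, fun x => by simp [h.mem_iff], Or.inl ⟨h.head_eq, h.last_eq⟩⟩

lemma mem_symEdges_of_mem_zip {l : List ℕ} {a b : ℕ} (h : (a, b) ∈ l.zip l.tail) :
    s(a, b) ∈ symEdges l := List.mem_map.2 ⟨(a, b), h, rfl⟩

lemma isEdgeOf_of_mem_symEdges (P : ℕ → Pt) {l : List ℕ} {a b : ℕ} (h : s(a, b) ∈ symEdges l) :
    IsEdgeOf (pathEdges (l.map P)) (P a) (P b) := by
  obtain ⟨⟨c, d⟩, hcd, he⟩ := List.mem_map.1 h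
  rw [pathEdges_map]
  rcases Sym2.eq_iff.1 he with ⟨rfl, rfl⟩ | ⟨rfl, rfl⟩
  · exact Or.inl (List.mem_map.2 ⟨_, hcd, rfl⟩)
  · exact Or.inr (List.mem_map.2 ⟨_, hcd, rfl⟩)

/-- The main statement for points labelled `0, …, N` so that the two end vertices of the path
are the points labelled `0` and `N`. -/
theorem optimum_path_of_labelling {n : ℕ} {R B : Finset Pt} (hdisj : Disjoint R B)
    (hR : R.card = n + 1) (hB : B.card = n) {P : ℕ → Pt} {N : ℕ}
    (hP : ∀ a b c, a < b → b < c → c ≤ N → det2 (P a) (P b) (P c) < 0)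
    (hinj : Set.InjOn P (Finset.range (N + 1)))
    (himg : (Finset.range (N + 1)).image P = R ∪ B) (h0 : P 0 ∈ R) (hN : P N ∈ R) {r r' : Pt}
    (hends : (P 0 = r ∧ P N = r') ∨ (P N = r ∧ P 0 = r')) (Q : HamAltPath R B r r')
    (hQ : OptimumPath R B r r' Q) :
    (crossNum (pathEdges Q.verts) +
        ((Finset.range N).filter fun t => P t ∈ R ∧ P (t + 1) ∈ B).card = n) ∧
      OnePlane (pathEdges Q.verts) ∧
      ∀ t < N, Bichromatic R B (P t, P (t + 1)) →
        IsEdgeOf (pathEdges Q.verts) (P t) (P (t + 1)) := by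
  set col : ℕ → Bool := fun t => decide (P t ∈ R) with hcol
  have hmemRB : ∀ {t}, t ≤ N → P t ∈ R ∨ P t ∈ B := fun {t} ht =>
    Finset.mem_union.1 (himg ▸ Finset.mem_image_of_mem P (by simp; omega))
  have hnot : ∀ {x}, x ∈ R → x ∉ B := fun {_} hx hx' => Finset.disjoint_left.1 hdisj hx hx'
  have hbi : ∀ {a b}, Bichromatic R B (P a, P b) → col a ≠ col b := by
    intro a b h
    rcases h with ⟨h1, h2⟩ | ⟨h1, h2⟩
    · have := fun h => hnot h h2
      simp_all
    · have := fun h => hnot h h1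
      simp_all
  have hbi' : ∀ {a b}, a ≤ N → b ≤ N → col a ≠ col b → Bichromatic R B (P a, P b) := by
    intro a b ha hb h
    have h1 := hmemRB ha
    have h2 := hmemRB hb
    by_cases ha : P a ∈ R <;> by_cases hb : P b ∈ R
    · simp [hcol, ha, hb] at h
    · exact Or.inl ⟨ha, h2.resolve_left hb⟩
    · exact Or.inr ⟨h1.resolve_left ha, hb⟩
    · simp [hcol, ha, hb] at h
  have hcard : N + 1 = 2 * n + 1 := by
    have := Finset.card_image_of_injOn hinj
    rw [himg, Finset.card_union_of_disjoint hdisj, Finset.card_range] at this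
    omega
  have hsum : (∑ t ∈ Finset.range (N + 1), if col t then (1 : ℤ) else -1) = 1 := by
    have h1 := Finset.sum_image (f := fun x => if x ∈ R then (1 : ℤ) else -1) hinj
    rw [himg, Finset.sum_union hdisj, Finset.sum_congr rfl fun x hx => if_pos hx,
      Finset.sum_congr rfl fun x hx => if_neg fun h => hnot h hx] at h1
    simp only [Finset.sum_const, hR, hB] at h1
    simp only [hcol, decide_eq_true_eq]
    rw [← h1]
    simp
  have transfer : ∀ {l}, ExtremalPath N l →
      2 * crossNum (pathEdges (l.map P)) = crossSum (symEdges l) ∧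
      ∀ i < (symEdges l).length, edgeCrossCount (pathEdges (l.map P)) i =
        crossDeg (symEdges l) ((symEdges l).getD i s(0, 0)) := by
    intro l hl
    have hlen : (pathEdges (l.map P)).length = (symEdges l).length := by
      simp [pathEdges_map, symEdges]
    have H := segCross_getD_iff hP hl.nodup fun x hx => (hl.mem_iff x).1 hx
    exact ⟨two_mul_crossNum_eq hlen H, fun i hi => edgeCrossCount_eq hlen H hi⟩
  have build : ∀ {l}, ExtremalPath N l → (∀ a b, s(a, b) ∈ symEdges l → col a ≠ col b) →
      (l.map P).head? = some r → (l.map P).getLast? = some r' →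
      crossNum (pathEdges Q.verts) ≤ crossNum (pathEdges (l.map P)) := by
    intro l hl halt hh hlast
    have hset : l.toFinset = Finset.range (N + 1) := by
      ext x
      simp [hl.mem_iff]
    refine hQ ⟨l.map P, ?_, ?_, hh, hlast, ?_⟩
    · refine (List.nodup_map_iff_inj_on hl.nodup).2 fun x hx y hy hxy => hinj ?_ ?_ hxy
      · simpa [Nat.lt_succ_iff] using (hl.mem_iff x).1 hx
      · simpa [Nat.lt_succ_iff] using (hl.mem_iff y).1 hy
    · rw [← himg, ← hset]
      ext x
      simp
    · intro e he
      rw [pathEdges_map] at he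
      obtain ⟨⟨a, b⟩, hab, rfl⟩ := List.mem_map.1 he
      have hab := mem_symEdges_of_mem_zip hab
      have hm := mem_of_mem_symEdges hab
      exact hbi' ((hl.mem_iff a).1 (hm a (by simp))) ((hl.mem_iff b).1 (hm b (by simp)))
        (halt a b hab)
  have hupper : 2 * crossNum (pathEdges Q.verts) ≤ monoCount col 0 N := by
    obtain ⟨l, hl⟩ := exists_ladderPath col (by simpa [hcol] using h0) (by simpa [hcol] using hN)
      hsum
    rcases hends with ⟨h1, h2⟩ | ⟨h1, h2⟩
    · have := build hl.extremalPath hl.alt (by simp [hl.head_eq, h1]) (by simp [hl.last_eq, h2])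
      have := (transfer hl.extremalPath).1
      have := hl.cross
      omega
    · have hrev : ExtremalPath N l.reverse :=
        ⟨List.nodup_reverse.2 hl.nodup, fun x => by simp [hl.mem_iff],
          Or.inr ⟨by simp [hl.last_eq], by simp [hl.head_eq]⟩⟩
      have hE := symEdges_reverse l
      have := build hrev (fun a b hab => hl.alt a b (by simpa [hE] using hab))
        (by simp [hl.last_eq, h1]) (by simp [hl.head_eq, h2])
      have := (transfer hrev).1
      rw [hE, crossSum_perm (List.reverse_perm _)] at this
      have := hl.cross
      omega
  obtain ⟨l, hl, hQl⟩ : ∃ l, ExtremalPath N l ∧ Q.verts = l.map P := by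
    have hex : ∀ x, ∃ t, x ∈ Q.verts → t ≤ N ∧ P t = x := by
      intro x
      by_cases hx : x ∈ Q.verts
      · rw [← List.mem_toFinset, Q.cover, ← himg] at hx
        obtain ⟨t, ht, rfl⟩ := Finset.mem_image.1 hx
        exact ⟨t, fun _ => ⟨by simpa [Nat.lt_succ_iff] using ht, rfl⟩⟩
      · exact ⟨0, fun h => absurd h hx⟩
    choose g hg using hex
    have hmap : (Q.verts.map g).map P = Q.verts := by
      rw [List.map_map]
      conv_rhs => rw [← List.map_id Q.verts]
      exact List.map_congr_left fun x hx => (hg x hx).2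
    have hgP : ∀ {t}, t ≤ N → P t ∈ Q.verts ∧ g (P t) = t := by
      intro t ht
      have hmem : P t ∈ Q.verts := by
        rw [← List.mem_toFinset, Q.cover, ← himg]
        exact Finset.mem_image_of_mem P (by simp; omega)
      have h1 := hg _ hmem
      exact ⟨hmem, hinj (by simpa [Nat.lt_succ_iff] using h1.1)
        (by simpa [Nat.lt_succ_iff] using ht) h1.2⟩
    refine ⟨Q.verts.map g, ⟨?_, fun x => ⟨fun hx => ?_, fun hx => ?_⟩, ?_⟩, hmap.symm⟩
    · refine List.Nodup.of_map P ?_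
      rw [hmap]
      exact Q.nodup
    · obtain ⟨y, hy, rfl⟩ := List.mem_map.1 hx
      exact (hg y hy).1
    · exact List.mem_map.2 ⟨P x, hgP hx⟩
    · rw [List.head?_map, List.getLast?_map, Q.head_eq, Q.last_eq]
      rcases hends with ⟨rfl, rfl⟩ | ⟨rfl, rfl⟩
      · exact Or.inl ⟨by simp [hgP], by simp [hgP]⟩
      · exact Or.inr ⟨by simp [hgP], by simp [hgP]⟩
  have halt : ∀ a b, s(a, b) ∈ symEdges l → col a ≠ col b := by
    intro a b hab
    rcases isEdgeOf_of_mem_symEdges P hab with h | h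
    · exact hbi (Q.alt _ (hQl ▸ h))
    · exact (hbi (Q.alt _ (hQl ▸ h))).symm
  have hT := transfer hl
  rw [← hQl] at hT
  have hfar := hl.farCount_le
  have hmono := hl.monoCount_le halt
  have heq : farCount (symEdges l) = crossSum (symEdges l) := by omega
  refine ⟨?_, fun i hi => ?_, fun t ht hb => ?_⟩
  · have h1 := monoCount_add col (by simpa [hcol] using h0) N
    rw [if_pos (by simpa [hcol] using hN)] at h1
    have h2 : ((Finset.range N).filter fun t => col t = true ∧ col (t + 1) = false) =
        (Finset.range N).filter fun t => P t ∈ R ∧ P (t + 1) ∈ B := by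
      refine Finset.filter_congr fun t ht => ?_
      have := hmemRB (t := t + 1) (by simpa using ht)
      have := @hnot (P (t + 1))
      simp only [hcol, decide_eq_true_eq, decide_eq_false_iff_not]
      tauto
    rw [h2] at h1
    omega
  · have hi' : i < (symEdges l).length := by
      simpa [hQl, pathEdges_map, symEdges] using hi
    rw [hT.2 i hi', List.getD_eq_getElem _ _ hi']
    by_cases hz : crossDeg (symEdges l) (symEdges l)[i] = 0
    · omega
    · rw [crossDeg_eq_zero] at hz
      push Not at hz
      obtain ⟨f, hf, hX⟩ := hz
      exact (hl.crossDeg_eq_one heq (List.getElem_mem hi') hf hX).le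
  · rw [hQl]
    exact isEdgeOf_of_mem_symEdges P (hmono.2 (by omega) t ht (hbi hb))

/-- Corollary 3.2(ii): for `S = R ∪ B` in convex position (listed clockwise by `pt`) with
`|R| = |B| + 1 = n + 1 ≥ 2` and consecutive red points `r, r' ∈ R`, every optimum
Hamiltonian alternating path on `S` with endpoints `r` and `r'` has exactly `n − b(S)`
crossings, is 1-plane, and contains every bridge of `S` as an edge. -/
theorem stmt10 (n : ℕ) (hn : 1 ≤ n) (R B : Finset Pt)
    (hdisj : Disjoint R B)
    (hR : R.card = n + 1) (hB : B.card = n)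
    (m : ℕ) (hm : 0 < m) (pt : Fin m → Pt)
    (hcw : CWList pt) (hcover : Finset.univ.image pt = R ∪ B)
    (r r' : Pt) (hr : r ∈ R) (hr' : r' ∈ R) (hne : r ≠ r')
    (hcons : ∃ i : Fin m,
      (pt i = r ∧ pt (cycSucc hm i) = r') ∨ (pt i = r' ∧ pt (cycSucc hm i) = r)) :
    ∀ P : HamAltPath R B r r', OptimumPath R B r r' P →
      crossNum (pathEdges P.verts) = n - runCount hm B R pt ∧
      OnePlane (pathEdges P.verts) ∧
      ∀ i : Fin m, Bichromatic R B (pt i, pt (cycSucc hm i)) →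
        IsEdgeOf (pathEdges P.verts) (pt i) (pt (cycSucc hm i)) := by
  intro Q hQ
  obtain ⟨k, hk⟩ := hcons
  obtain ⟨N, rfl⟩ : ∃ N, m = N + 1 := ⟨m - 1, by omega⟩
  set idx : ℕ → Fin (N + 1) := fun t => ⟨(k.val + 1 + t) % (N + 1), Nat.mod_lt _ hm⟩ with hidx
  have hidxval : ∀ {t}, t ≤ N → (idx t).val =
      if k.val + 1 + t < N + 1 then k.val + 1 + t else k.val + 1 + t - (N + 1) := by
    intro t ht
    have := k.isLt
    simp only [hidx]
    split_ifs with h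
    · exact Nat.mod_eq_of_lt h
    · rw [Nat.mod_eq_sub_mod (by omega), Nat.mod_eq_of_lt (by omega)]
  have hidx0 : idx 0 = cycSucc hm k := rfl
  have hidxN : idx N = k := by
    have := k.isLt
    ext
    rw [hidxval le_rfl]
    split_ifs <;> omega
  have hsucc : ∀ t, cycSucc hm (idx t) = idx (t + 1) := by
    intro t
    ext
    simp only [cycSucc, hidx, Nat.mod_add_mod]
    rfl
  have hpred : ∀ t, cycPred hm (idx (t + 1)) = idx t := by
    intro t
    ext
    simp only [cycPred, hidx, Nat.mod_add_mod]
    rw [show k.val + 1 + (t + 1) + (N + 1 - 1) = k.val + 1 + t + (N + 1) by omega,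
      Nat.add_mod_right]
  have hidxinj : ∀ {a b}, a ≤ N → b ≤ N → idx a = idx b → a = b := by
    intro a b ha hb h
    have h := congrArg Fin.val h
    rw [hidxval ha, hidxval hb] at h
    split_ifs at h <;> omega
  have hidxsurj : ∀ j, ∃ t ≤ N, idx t = j := by
    intro j
    have := k.isLt
    have := j.isLt
    by_cases h : k.val + 1 ≤ j.val
    · refine ⟨j.val - (k.val + 1), by omega, ?_⟩
      ext
      rw [hidxval (by omega)]
      split_ifs <;> omega
    · refine ⟨j.val + (N + 1) - (k.val + 1), by omega, ?_⟩
      ext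
      rw [hidxval (by omega)]
      split_ifs <;> omega
  have hends : (pt (idx 0) = r ∧ pt (idx N) = r') ∨ (pt (idx N) = r ∧ pt (idx 0) = r') := by
    rw [hidx0, hidxN]
    tauto
  have h0R : pt (idx 0) ∈ R := by
    rcases hends with h | h
    · exact h.1 ▸ hr
    · exact h.2 ▸ hr'
  have hNR : pt (idx N) ∈ R := by
    rcases hends with h | h
    · exact h.2 ▸ hr'
    · exact h.1 ▸ hr
  have hnot : ∀ {x}, x ∈ R → x ∉ B := fun {_} hx hx' => Finset.disjoint_left.1 hdisj hx hx'
  obtain ⟨h1, h2, h3⟩ := optimum_path_of_labelling (P := fun t => pt (idx t)) hdisj hR hB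
    (N := N) (fun a b c hab hbc hc => by
      have ha := hidxval (t := a) (by omega)
      have hb := hidxval (t := b) (by omega)
      have hc := hidxval hc
      have := k.isLt
      rcases Nat.lt_or_ge (k.val + 1 + c) (N + 1) with h | h
      · rw [if_pos (by omega)] at ha hb hc
        exact hcw.2 _ _ _ (Fin.lt_def.2 (by omega)) (Fin.lt_def.2 (by omega))
      rw [if_neg (by omega)] at hc
      rcases Nat.lt_or_ge (k.val + 1 + b) (N + 1) with h | h
      · rw [if_pos (by omega)] at ha hb
        rw [← det2_rotate, ← det2_rotate]
        exact hcw.2 _ _ _ (Fin.lt_def.2 (by omega)) (Fin.lt_def.2 (by omega))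
      rw [if_neg (by omega)] at hb
      rcases Nat.lt_or_ge (k.val + 1 + a) (N + 1) with h | h
      · rw [if_pos (by omega)] at ha
        rw [← det2_rotate]
        exact hcw.2 _ _ _ (Fin.lt_def.2 (by omega)) (Fin.lt_def.2 (by omega))
      · rw [if_neg (by omega)] at ha
        exact hcw.2 _ _ _ (Fin.lt_def.2 (by omega)) (Fin.lt_def.2 (by omega)))
    (fun a ha b hb hab => by
      rw [Finset.coe_range, Set.mem_Iio] at ha hb
      exact hidxinj (by omega) (by omega) (hcw.1 hab))
    (by
      rw [← hcover]
      ext x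
      simp only [Finset.mem_image, Finset.mem_range, Finset.mem_univ, true_and]
      constructor
      · rintro ⟨t, -, rfl⟩
        exact ⟨_, rfl⟩
      · rintro ⟨j, rfl⟩
        obtain ⟨t, ht, rfl⟩ := hidxsurj j
        exact ⟨t, by omega, rfl⟩)
    h0R hNR hends Q hQ
  refine ⟨?_, h2, fun j hj => ?_⟩
  · have hrun : runCount hm B R pt = ((Finset.range N).filter fun t =>
        pt (idx t) ∈ R ∧ pt (idx (t + 1)) ∈ B).card := by
      rw [runCount, if_neg fun h => hnot h0R (h _)]
      symm
      refine Finset.card_bij (fun t _ => idx (t + 1)) ?_ ?_ ?_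
      · intro t ht
        have ht := (Finset.mem_filter.1 ht).2
        rw [Finset.mem_filter, hpred]
        exact ⟨Finset.mem_univ _, ht.2, ht.1⟩
      · intro a ha b hb hab
        have ha := Finset.mem_range.1 (Finset.mem_filter.1 ha).1
        have hb := Finset.mem_range.1 (Finset.mem_filter.1 hb).1
        have := hidxinj (by omega) (by omega) hab
        omega
      · intro j hj
        obtain ⟨t, ht, rfl⟩ := hidxsurj j
        obtain ⟨-, hj1, hj2⟩ := Finset.mem_filter.1 hj
        cases t with
        | zero => exact absurd hj1 (hnot h0R)
        | succ t =>
          rw [hpred] at hj2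
          exact ⟨t, Finset.mem_filter.2 ⟨Finset.mem_range.2 (by omega), hj2, hj1⟩, rfl⟩
    omega
  · obtain ⟨t, ht, rfl⟩ := hidxsurj j
    rcases ht.eq_or_lt with rfl | ht
    · rw [hidxN, ← hidx0, ← hidxN] at hj
      rcases hj with hj | hj
      · exact absurd hj.2 (hnot h0R)
      · exact absurd hj.1 (hnot hNR)
    · rw [hsucc] at hj ⊢
      exact h3 t ht hj

end
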